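/- Assume ⊢^R is contrapositive for assumptions. If φ ∈ CN(⋂MCS(S,A) ∪ S), then every preferred extension of the sequent-based ABA-framework contains an argument A' ⟨ Γ ⇒ φ with A' ⊆ A and Γ ⊆ S. -/

import Mathlib

/-- A rule `φ₁,…,φₙ → φ` of a deductive system: premises and a conclusion. -/
abbrev Rule (F : Type) := List F × F

/-- Deducibility `Γ ⊢^R φ`: chaining rules of `R` from members of `Γ`. -/
inductive Ded {F : Type} (R : Set (Rule F)) (Γ : Set F) : F → Prop
  | mem {φ : F} : φ ∈ Γ → Ded R Γ φ
  | app {l : List F} {φ : F} : (l, φ) ∈ R → (∀ ψ ∈ l, Ded R Γ ψ) → Ded R Γ φ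

/-- Derivability of assumptive sequents `A' ⟨ Γ ⇒ Δ` in the calculus `R_⇒`:
the sequents `μ(r)` for `r ∈ R`, the identity axiom, the two cut rules, and the
rules `AS_ABA` moving a formula of the assumption set `AS` between the
assumption component and the left-hand side of `⇒`. -/
inductive SeqDer {F : Type} [DecidableEq F] (R : Set (Rule F)) (AS : Set F) :
    Finset F → Finset F → Finset F → Prop
  | id (φ : F) : SeqDer R AS ∅ {φ} {φ}
  | mu {l : List F} {φ : F} : (l, φ) ∈ R → SeqDer R AS ∅ l.toFinset {φ}
  | cutLhs {A₁ A₂ Γ₁ Γ₂ Δ₁ Δ₂ : Finset F} {φ : F} :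
      SeqDer R AS A₁ Γ₁ (insert φ Δ₁) → SeqDer R AS A₂ (insert φ Γ₂) Δ₂ →
      SeqDer R AS (A₁ ∪ A₂) (Γ₁ ∪ Γ₂) (Δ₁ ∪ Δ₂)
  | cutAss {A₁ A₂ Γ₁ Γ₂ Δ₁ Δ₂ : Finset F} {φ : F} :
      SeqDer R AS A₁ Γ₁ (insert φ Δ₁) → SeqDer R AS (insert φ A₂) Γ₂ Δ₂ →
      SeqDer R AS (A₁ ∪ A₂) (Γ₁ ∪ Γ₂) (Δ₁ ∪ Δ₂)
  | toAss {A' Γ Δ : Finset F} {φ : F} :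
      φ ∈ AS → SeqDer R AS A' (insert φ Γ) Δ → SeqDer R AS (insert φ A') Γ Δ
  | toLhs {A' Γ Δ : Finset F} {φ : F} :
      φ ∈ AS → SeqDer R AS (insert φ A') Γ Δ → SeqDer R AS A' (insert φ Γ) Δ

/-- An argument: an assumption component, a support (strict premises) and a conclusion. -/
structure Argu (F : Type) where
  ass : Finset F
  supp : Finset F
  concl : F

/-- `a` is an ABA-argument based on `S` and `A`: a deduction `ass(a) ∪ supp(a) ⊢^R conc(a)`
with finite `ass(a) ⊆ A` and finite `supp(a) ⊆ S`. -/
def IsABAArg {F : Type} (R : Set (Rule F)) (S A : Set F) (a : Argu F) : Prop :=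
  ↑a.ass ⊆ A ∧ ↑a.supp ⊆ S ∧ Ded R (↑a.ass ∪ ↑a.supp) a.concl

/-- `a` is an assumptive sequent argument based on `S` and `A`: a sequent
`ass(a) ⟨ supp(a) ⇒ conc(a)` derivable in `R_⇒`, with `ass(a) ⊆ A` and `supp(a) ⊆ S`. -/
def IsSeqArg {F : Type} [DecidableEq F] (R : Set (Rule F)) (S A : Set F) (a : Argu F) : Prop :=
  ↑a.ass ⊆ A ∧ ↑a.supp ⊆ S ∧ SeqDer R A a.ass a.supp {a.concl}

/-- `a` attacks `b` iff the conclusion of `a` is the contrary of some assumption of `b`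
(this is the ABA attack, and also the sequent-based `AT_ABA` attack). -/
def Attacks {F : Type} (contrary : F → F) (a b : Argu F) : Prop :=
  ∃ ψ ∈ b.ass, a.concl = contrary ψ

/-- `E` is conflict-free: a set of arguments of the framework no member of which attacks a member. -/
def ConflictFree {α : Type} (Args : Set α) (att : α → α → Prop) (E : Set α) : Prop :=
  E ⊆ Args ∧ ∀ a ∈ E, ∀ b ∈ E, ¬ att a b

/-- `E` defends `a`: `E` attacks every attacker of `a`. -/
def Defends {α : Type} (Args : Set α) (att : α → α → Prop) (E : Set α) (a : α) : Prop :=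
  ∀ b ∈ Args, att b a → ∃ c ∈ E, att c b

/-- `E` is admissible: conflict-free and defending all of its elements. -/
def Admissible {α : Type} (Args : Set α) (att : α → α → Prop) (E : Set α) : Prop :=
  ConflictFree Args att E ∧ ∀ a ∈ E, Defends Args att E a

/-- A complete extension: an admissible set containing every argument it defends. -/
def CompleteExt {α : Type} (Args : Set α) (att : α → α → Prop) (E : Set α) : Prop :=
  Admissible Args att E ∧ ∀ a ∈ Args, Defends Args att E a → a ∈ E

/-- The grounded extension: the ⊆-minimal complete extension. -/
def GroundedExt {α : Type} (Args : Set α) (att : α → α → Prop) (E : Set α) : Prop :=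
  CompleteExt Args att E ∧ ∀ E', CompleteExt Args att E' → E ⊆ E'

/-- A preferred extension: a ⊆-maximal complete extension. -/
def PreferredExt {α : Type} (Args : Set α) (att : α → α → Prop) (E : Set α) : Prop :=
  CompleteExt Args att E ∧ ∀ E', CompleteExt Args att E' → E ⊆ E' → E' = E

/-- A set `A'` of assumptions is consistent iff there is no `φ ∈ A'` with
`A'' ∪ Γ ⊢^R φ̄` for some `A'' ⊆ A'` and `Γ ⊆ S`. -/
def ConsistentSet {F : Type} (R : Set (Rule F)) (contrary : F → F) (S : Set F)
    (A' : Set F) : Prop :=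
  ¬ ∃ φ ∈ A', ∃ A'' ⊆ A', ∃ Γ ⊆ S, Ded R (A'' ∪ Γ) (contrary φ)

/-- `MCS(S,A)`: the set of ⊆-maximal consistent subsets of `A`. -/
def MCS {F : Type} (R : Set (Rule F)) (contrary : F → F) (S A : Set F) : Set (Set F) :=
  {T | T ⊆ A ∧ ConsistentSet R contrary S T ∧
    ∀ T', T ⊆ T' → T' ⊆ A → ConsistentSet R contrary S T' → T' = T}

/-- `CN(T) = {φ | Γ ⊢^R φ for some Γ ⊆ T}`. -/
def CN {F : Type} (R : Set (Rule F)) (T : Set F) : Set F :=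
  {φ | ∃ Γ ⊆ T, Ded R Γ φ}

/-- `⊢^R` is contrapositive for assumptions: for all `φ, ψ` in an assumption set `A'`
and `Γ ⊆ S`, `A' ∪ Γ ⊢^R ψ̄` iff `(A' \ {φ}) ∪ {ψ} ∪ Γ ⊢^R φ̄`. -/
def Contrapositive {F : Type} (R : Set (Rule F)) (contrary : F → F) (S A : Set F) : Prop :=
  ∀ A' ⊆ A, ∀ Γ ⊆ S, ∀ φ ∈ A', ∀ ψ ∈ A',
    (Ded R (A' ∪ Γ) (contrary ψ) ↔ Ded R ((A' \ {φ}) ∪ {ψ} ∪ Γ) (contrary φ))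

theorem Ded.mono {F : Type} {R : Set (Rule F)} {X Y : Set F} (hXY : X ⊆ Y) {φ : F}
    (h : Ded R X φ) : Ded R Y φ := by
  induction h with
  | mem h => exact .mem (hXY h)
  | app hr _ ih => exact .app hr ih

theorem Ded.trans {F : Type} {R : Set (Rule F)} {X Y : Set F} {φ : F}
    (h : Ded R X φ) (hX : ∀ ψ ∈ X, Ded R Y ψ) : Ded R Y φ := by
  induction h with
  | mem h => exact hX _ h
  | app hr _ ih => exact .app hr ih

/-- The calculus is sound when the right-hand side of a sequent is read conjunctively. -/
theorem SeqDer.ded {F : Type} [DecidableEq F] {R : Set (Rule F)} {AS : Set F}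
    {A Γ Δ : Finset F} (h : SeqDer R AS A Γ Δ) : ∀ δ ∈ Δ, Ded R (↑A ∪ ↑Γ) δ := by
  induction h with
  | id φ => intro δ hδ; exact .mem (by simpa using hδ)
  | mu hr =>
    intro δ hδ
    obtain rfl := Finset.mem_singleton.1 hδ
    exact .app hr fun ψ hψ => .mem (by simpa using hψ)
  | cutLhs _ _ ih₁ ih₂ | cutAss _ _ ih₁ ih₂ =>
    intro δ hδ
    rcases Finset.mem_union.1 hδ with hδ | hδ
    · refine (ih₁ δ (Finset.mem_insert_of_mem hδ)).mono fun x hx => ?_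
      simp only [Set.mem_union, Finset.mem_coe, Finset.mem_union] at hx ⊢
      tauto
    · refine (ih₂ δ hδ).trans fun ψ hψ => ?_
      simp only [Set.mem_union, Finset.mem_coe, Finset.mem_insert, or_assoc] at hψ
      rcases hψ with h | h | h <;> first
        | subst h
          refine (ih₁ _ (Finset.mem_insert_self _ _)).mono fun x hx => ?_
          simp only [Set.mem_union, Finset.mem_coe, Finset.mem_union] at hx ⊢
          tauto
        | exact .mem (by simp [h])
  | toAss _ _ ih | toLhs _ _ ih =>
    intro δ hδ
    refine (ih δ hδ).mono fun x hx => ?_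
    simp only [Set.mem_union, Finset.mem_coe, Finset.mem_insert] at hx ⊢
    tauto

theorem SeqDer.cut_finset {F : Type} [DecidableEq F] {R : Set (Rule F)} {AS X : Set F}
    {φ : F} (L : Finset F)
    (hL : ∀ ψ ∈ L, ∃ Γ : Finset F, ↑Γ ⊆ X ∧ SeqDer R AS ∅ Γ {ψ}) (Γ : Finset F) (hΓ : ↑Γ ⊆ X)
    (h : SeqDer R AS ∅ (L ∪ Γ) {φ}) : ∃ Γ' : Finset F, ↑Γ' ⊆ X ∧ SeqDer R AS ∅ Γ' {φ} := by
  induction L using Finset.induction_on generalizing Γ with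
  | empty => exact ⟨Γ, hΓ, by simpa using h⟩
  | insert ψ L _ ih =>
    obtain ⟨Γ₁, hΓ₁, h₁⟩ := hL ψ (Finset.mem_insert_self _ _)
    refine ih (fun χ hχ => hL χ (Finset.mem_insert_of_mem hχ)) (Γ₁ ∪ Γ) ?_ ?_
    · rw [Finset.coe_union]
      exact Set.union_subset hΓ₁ hΓ
    · rw [Finset.insert_union] at h
      have h₂ := SeqDer.cutLhs (Δ₁ := ∅) (by simpa using h₁) h
      rw [Finset.union_left_comm]
      simpa using h₂

theorem Ded.exists_seqDer {F : Type} [DecidableEq F] {R : Set (Rule F)} {X : Set F} {φ : F}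
    (AS : Set F) (h : Ded R X φ) :
    ∃ Γ : Finset F, ↑Γ ⊆ X ∧ SeqDer R AS ∅ Γ {φ} := by
  induction h with
  | @mem φ h => exact ⟨{φ}, by simpa using h, .id φ⟩
  | app hr _ ih =>
    exact SeqDer.cut_finset _ (fun ψ hψ => ih ψ (List.mem_toFinset.1 hψ)) ∅ (by simp)
      (by simpa using SeqDer.mu hr)

theorem SeqDer.move_to_ass {F : Type} [DecidableEq F] {R : Set (Rule F)} {AS : Set F}
    {Γ Δ : Finset F} (B : Finset F) (hB : ↑B ⊆ AS) (A : Finset F)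
    (h : SeqDer R AS A (B ∪ Γ) Δ) : SeqDer R AS (B ∪ A) Γ Δ := by
  induction B using Finset.induction_on generalizing A with
  | empty => simpa using h
  | insert ψ B _ ih =>
    rw [Finset.coe_insert, Set.insert_subset_iff] at hB
    rw [Finset.insert_union] at h
    simpa using ih hB.2 _ (h.toAss hB.1)

/-- Completeness of the calculus, restricted to arguments over `T`. -/
theorem Ded.exists_isSeqArg {F : Type} [DecidableEq F] {R : Set (Rule F)} {S A T : Set F}
    {φ : F} (hT : T ⊆ A) (h : Ded R (T ∪ S) φ) :
    ∃ a : Argu F, IsSeqArg R S A a ∧ ↑a.ass ⊆ T ∧ a.concl = φ := by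
  classical
  obtain ⟨Γ, hΓ, hder⟩ := h.exists_seqDer A
  have hass : ↑(Γ.filter (· ∈ T)) ⊆ T := fun x hx => by simp at hx; exact hx.2
  refine ⟨⟨Γ.filter (· ∈ T), Γ.filter (· ∉ T), φ⟩, ⟨hass.trans hT, fun x hx => ?_, ?_⟩, hass, rfl⟩
  · simp at hx
    exact (hΓ hx.1).resolve_left hx.2
  · simpa using SeqDer.move_to_ass (Γ := Γ.filter (· ∉ T)) _ (hass.trans hT) ∅
      (by rwa [Finset.filter_union_filter_not_eq])

theorem IsSeqArg.ded {F : Type} [DecidableEq F] {R : Set (Rule F)} {S A : Set F} {a : Argu F}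
    (h : IsSeqArg R S A a) : Ded R (↑a.ass ∪ S) a.concl :=
  (h.2.2.ded _ (Finset.mem_singleton_self _)).mono (Set.union_subset_union_right _ h.2.1)

theorem consistentSet_iff {F : Type} {R : Set (Rule F)} {contrary : F → F} {S T : Set F} :
    ConsistentSet R contrary S T ↔ ∀ φ ∈ T, ¬ Ded R (T ∪ S) (contrary φ) := by
  constructor
  · exact fun h φ hφ hd => h ⟨φ, hφ, T, subset_rfl, S, subset_rfl, hd⟩
  · rintro h ⟨φ, hφ, T', hT', Γ, hΓ, hd⟩
    exact h φ hφ (hd.mono (Set.union_subset_union hT' hΓ))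

theorem ConsistentSet.exists_mcs {F : Type} [DecidableEq F] {R : Set (Rule F)}
    {contrary : F → F} {S A T : Set F} (hTA : T ⊆ A) (hT : ConsistentSet R contrary S T) :
    ∃ M ∈ MCS R contrary S A, T ⊆ M := by
  obtain ⟨M, hTM, hM⟩ := zorn_subset_nonempty {T | T ⊆ A ∧ ConsistentSet R contrary S T}
    (fun c hc hchain hne => by
      have hcA : ⋃₀ c ⊆ A := Set.sUnion_subset fun t ht => (hc ht).1
      refine ⟨⋃₀ c, ⟨hcA, ?_⟩, fun t ht => Set.subset_sUnion_of_mem ht⟩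
      rw [consistentSet_iff]
      intro φ hφ hd
      obtain ⟨a, ha, hac, haφ⟩ := hd.exists_isSeqArg hcA
      have hfin : ↑(insert φ a.ass) ⊆ ⋃₀ c := by
        rw [Finset.coe_insert]
        exact Set.insert_subset hφ hac
      obtain ⟨t, ht, hat⟩ := hchain.directedOn.exists_mem_subset_of_finite_of_subset_sUnion
        hne (Finset.finite_toSet _) hfin
      rw [Finset.coe_insert, Set.insert_subset_iff] at hat
      exact consistentSet_iff.1 (hc ht).2 φ hat.1
        (haφ ▸ ha.ded.mono (Set.union_subset_union_left _ hat.2)))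
    T ⟨hTA, hT⟩
  exact ⟨M, ⟨hM.prop.1, hM.prop.2, fun T' h h₁ h₂ => (hM.eq_of_subset ⟨h₁, h₂⟩ h).symm⟩, hTM⟩

/-- In a contrapositive system, a set of assumptions refuting one of its members `ψ` refutes
every other member `φ`, without using `φ` itself. -/
theorem Contrapositive.ded_diff {F : Type} {R : Set (Rule F)} {contrary : F → F} {S A T : Set F}
    (hcp : Contrapositive R contrary S A) (hT : T ⊆ A) {φ ψ : F} (hφ : φ ∈ T) (hψ : ψ ∈ T)
    (hne : φ ≠ ψ) (h : Ded R (T ∪ S) (contrary ψ)) : Ded R (T \ {φ} ∪ S) (contrary φ) := by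
  have hsub : {ψ} ⊆ T \ {φ} := Set.singleton_subset_iff.2 ⟨hψ, hne.symm⟩
  simpa only [Set.union_eq_self_of_subset_right hsub] using
    (hcp T hT S subset_rfl φ hφ ψ hψ).1 h

theorem MCS.ded_contrary {F : Type} {R : Set (Rule F)} {contrary : F → F} {S A T : Set F}
    (hcp : Contrapositive R contrary S A) (hT : T ∈ MCS R contrary S A) {b : F} (hb : b ∈ A)
    (hbT : b ∉ T) : Ded R (insert b T ∪ S) (contrary b) := by
  have hsub : insert b T ⊆ A := Set.insert_subset hb hT.1
  have hinc : ¬ ConsistentSet R contrary S (insert b T) := fun hc =>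
    hbT (hT.2.2 _ (Set.subset_insert _ _) hsub hc ▸ Set.mem_insert _ _)
  rw [consistentSet_iff] at hinc
  push Not at hinc
  obtain ⟨χ, hχ, hd⟩ := hinc
  by_cases hχb : b = χ
  · exact hχb ▸ hd
  · exact (hcp.ded_diff hsub (Set.mem_insert _ _) hχ hχb hd).mono
      (Set.union_subset_union_left _ Set.sdiff_subset)

theorem MCS.ded_contrary_of_nonempty {F : Type} {R : Set (Rule F)} {contrary : F → F}
    {S A T : Set F} (hcp : Contrapositive R contrary S A) (hT : T ∈ MCS R contrary S A)
    (hne : T.Nonempty) {b : F} (hb : b ∈ A) (hbT : b ∉ T) : Ded R (T ∪ S) (contrary b) := by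
  obtain ⟨ψ, hψ⟩ := hne
  have hsub : insert b T ⊆ A := Set.insert_subset hb hT.1
  have hψb : ψ ≠ b := fun h => hbT (h ▸ hψ)
  have hd := (hcp.ded_diff hsub (Set.mem_insert_of_mem _ hψ) (Set.mem_insert _ _) hψb
    (MCS.ded_contrary hcp hT hb hbT)).mono (Set.union_subset_union_left _ Set.sdiff_subset)
  refine (hcp.ded_diff hsub (Set.mem_insert _ _) (Set.mem_insert_of_mem _ hψ) hψb.symm hd).mono
    (Set.union_subset_union_left _ ?_)
  rintro x ⟨rfl | hx, hxb⟩
  · exact absurd rfl hxb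
  · exact hx

/-- The arguments of the sequent-based framework whose assumptions lie in `T`. -/
def argsOver {F : Type} [DecidableEq F] (R : Set (Rule F)) (S A T : Set F) : Set (Argu F) :=
  {a | IsSeqArg R S A a ∧ ↑a.ass ⊆ T}

theorem MCS.completeExt_argsOver {F : Type} [DecidableEq F] {R : Set (Rule F)}
    {contrary : F → F} {S A T : Set F} (hcp : Contrapositive R contrary S A)
    (hT : T ∈ MCS R contrary S A) :
    CompleteExt {a | IsSeqArg R S A a} (Attacks contrary) (argsOver R S A T) := by
  have hcons := consistentSet_iff.1 hT.2.1
  have hcf : ∀ a ∈ argsOver R S A T, ∀ b ∈ argsOver R S A T, ¬ Attacks contrary a b := by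
    rintro a ⟨ha, haT⟩ b ⟨-, hbT⟩ ⟨ψ, hψ, hc⟩
    exact hcons ψ (hbT hψ) (hc ▸ ha.ded.mono (Set.union_subset_union_left _ haT))
  refine ⟨⟨⟨fun a ha => ha.1, hcf⟩, ?_⟩, ?_⟩
  · rintro a ⟨-, haT⟩ b hb ⟨ψ, hψ, hc⟩
    have hbT : ¬ (↑b.ass : Set F) ⊆ T := fun hbT =>
      hcons ψ (haT hψ) (hc ▸ IsSeqArg.ded hb |>.mono (Set.union_subset_union_left _ hbT))
    obtain ⟨β, hβ, hβT⟩ := Set.not_subset.1 hbT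
    obtain ⟨c, hc, hcT, hcβ⟩ := (MCS.ded_contrary_of_nonempty hcp hT ⟨ψ, haT hψ⟩
      (hb.1 hβ) hβT).exists_isSeqArg hT.1
    exact ⟨c, ⟨hc, hcT⟩, β, hβ, hcβ⟩
  · intro a ha hdef
    refine ⟨ha, fun β hβ => ?_⟩
    by_contra hβT
    obtain ⟨d, hd, hdT, hdβ⟩ := (MCS.ded_contrary hcp hT (ha.1 hβ) hβT).exists_isSeqArg
      (Set.insert_subset (ha.1 hβ) hT.1)
    obtain ⟨c, hc, ψ, hψ, hcψ⟩ := hdef d hd ⟨β, hβ, hdβ⟩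
    rcases hdT hψ with rfl | hψT
    · obtain ⟨c', hc', hatt⟩ := hdef c hc.1 ⟨ψ, hβ, hcψ⟩
      exact hcf c' hc' c hc hatt
    · exact hcons ψ hψT (hcψ ▸ hc.1.ded.mono (Set.union_subset_union_left _ hc.2))

theorem CompleteExt.consistentSet {F : Type} [DecidableEq F] {R : Set (Rule F)}
    {contrary : F → F} {S A : Set F} {E : Set (Argu F)}
    (hE : CompleteExt {a | IsSeqArg R S A a} (Attacks contrary) E) :
    ConsistentSet R contrary S {x | ∃ a ∈ E, x ∈ a.ass} := by
  rw [consistentSet_iff]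
  rintro φ ⟨e, he, hφ⟩ hd
  have hsub : {x | ∃ a ∈ E, x ∈ a.ass} ⊆ A := fun x ⟨a, ha, hx⟩ => (hE.1.1.1 ha).1 hx
  obtain ⟨a, ha, haT, haφ⟩ := hd.exists_isSeqArg hsub
  have haE : a ∈ E := by
    refine hE.2 a ha ?_
    rintro b hb ⟨ψ, hψ, hbψ⟩
    obtain ⟨e', he', hψ'⟩ := haT hψ
    exact hE.1.2 e' he' b hb ⟨ψ, hψ', hbψ⟩
  exact hE.1.1.2 a haE e he ⟨φ, hφ, haφ⟩

theorem PreferredExt.exists_mcs {F : Type} [DecidableEq F] {R : Set (Rule F)}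
    {contrary : F → F} {S A : Set F} {E : Set (Argu F)} (hcp : Contrapositive R contrary S A)
    (hE : PreferredExt {a | IsSeqArg R S A a} (Attacks contrary) E) :
    ∃ T ∈ MCS R contrary S A, argsOver R S A T = E := by
  obtain ⟨T, hT, hET⟩ := hE.1.consistentSet.exists_mcs (A := A)
    (by rintro x ⟨a, ha, hx⟩; exact (hE.1.1.1.1 ha).1 hx)
  exact ⟨T, hT, hE.2 _ (MCS.completeExt_argsOver hcp hT)
    fun a ha => ⟨hE.1.1.1.1 ha, fun x hx => hET ⟨a, ha, hx⟩⟩⟩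


/-- Assuming `⊢^R` is contrapositive for assumptions: if `φ ∈ CN(⋂MCS(S,A) ∪ S)`,
then every preferred extension of the sequent-based ABA-framework contains an
argument `A' ⟨ Γ ⇒ φ` with `A' ⊆ A` and `Γ ⊆ S`. -/
theorem stmt14 {F V : Type} [DecidableEq F]
    (R : Set (Rule F)) (S A : Set F) (contrary : F → F) (atoms : F → Set V)
    (hA : A.Nonempty) (hSA : S ∩ A = ∅)
    (hNT : ∀ φ : F, (∀ s ∈ S, Disjoint (atoms φ) (atoms s)) → ¬ Ded R S φ)
    (hcp : Contrapositive R contrary S A) (φ : F)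
    (h : φ ∈ CN R (⋂₀ MCS R contrary S A ∪ S)) :
    ∀ E, PreferredExt {a | IsSeqArg R S A a} (Attacks contrary) E →
      ∃ a ∈ E, (a.ass : Set F) ⊆ A ∧ (a.supp : Set F) ⊆ S ∧ a.concl = φ := by
  intro E hE
  obtain ⟨T, hT, rfl⟩ := hE.exists_mcs hcp
  obtain ⟨Γ, hΓ, hd⟩ := h
  obtain ⟨a, ha, haT, haφ⟩ := (hd.mono (hΓ.trans
    (Set.union_subset_union_left _ (Set.sInter_subset_of_mem hT)))).exists_isSeqArg hT.1
  exact ⟨a, ⟨ha, haT⟩, ha.1, ha.2.1, haφ⟩
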